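/- Let G be a group with a left-invariant linear order <, and let e : 𝒞 → ℝ be an embedding map for the set 𝒞 of order divisions of G. Let t ∈ ℝ with t ∉ e(𝒞), and set a = sup{e(C) : C ∈ 𝒞, e(C) ≤ t} and b = inf{e(C) : C ∈ 𝒞, e(C) ≥ t}. Then a < b, the open interval (a, b) is disjoint from e(𝒞), and at least one of a, b belongs to e(𝒞); consequently the connected component of ℝ − e(𝒞) containing t equals (a, b), [a, b), or (a, b]. (Interval-type lemma, Subsection 4.2 of the paper.) -/

import Mathlib

/-- An *order division* of a left-ordered group `G` is a nonempty proper subset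
`C ⊊ G` that is downward closed: whenever `a ∈ C` and `b < a`, then `b ∈ C`. -/
def IsOrderDivision {G : Type*} [Group G] [LinearOrder G] (C : Set G) : Prop :=
  C.Nonempty ∧ C ≠ Set.univ ∧ ∀ a ∈ C, ∀ b : G, b < a → b ∈ C

/-- An *embedding map* for the set `𝒞` of order divisions of `G` is a map
`e : Set G → ℝ` that, on order divisions, is injective, order-preserving with
respect to `⊊` and `<`, and unbounded on both sides. -/
def IsEmbeddingMap {G : Type*} [Group G] [LinearOrder G] (e : Set G → ℝ) : Prop :=
  Set.InjOn e {C : Set G | IsOrderDivision C} ∧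
  (∀ X : Set G, IsOrderDivision X → ∀ Y : Set G, IsOrderDivision Y →
    (e X < e Y ↔ X ⊂ Y)) ∧
  ∀ N : ℝ, 0 < N →
    (∃ C₁ : Set G, IsOrderDivision C₁ ∧ e C₁ > N) ∧
    (∃ C₂ : Set G, IsOrderDivision C₂ ∧ e C₂ < -N)

/-- `e⁻(C) = sup {e(X) : X ∈ 𝒞, X ⊊ C}`. -/
noncomputable def eMinus {G : Type*} [Group G] [LinearOrder G]
    (e : Set G → ℝ) (C : Set G) : ℝ :=
  sSup (e '' {X : Set G | IsOrderDivision X ∧ X ⊂ C})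

/-- `e⁺(C) = inf {e(X) : X ∈ 𝒞, C ⊊ X}`. -/
noncomputable def ePlus {G : Type*} [Group G] [LinearOrder G]
    (e : Set G → ℝ) (C : Set G) : ℝ :=
  sInf (e '' {X : Set G | IsOrderDivision X ∧ C ⊂ X})

/-- `C` is an *upward gap place* with respect to `e` if `e(C) > e⁻(C)`. -/
def UpwardGapPlace {G : Type*} [Group G] [LinearOrder G]
    (e : Set G → ℝ) (C : Set G) : Prop :=
  eMinus e C < e C

/-- `C` is a *downward gap place* with respect to `e` if `e(C) < e⁺(C)`. -/
def DownwardGapPlace {G : Type*} [Group G] [LinearOrder G]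
    (e : Set G → ℝ) (C : Set G) : Prop :=
  e C < ePlus e C

/-- The connected component of `t` in `Sᶜ` is any order-connected set `J` containing `t` that lies
in `Sᶜ` and contains every point of `Sᶜ` between the supremum of `S` below `t` and the infimum of
`S` above `t`. -/
theorem connectedComponentIn_compl_eq {S J : Set ℝ} {t a b : ℝ}
    (ha : IsLUB (S ∩ Set.Iic t) a) (hb : IsGLB (S ∩ Set.Ici t) b)
    (hJ : J.OrdConnected) (htJ : t ∈ J) (hJS : J ⊆ Sᶜ) (hJ' : Set.Icc a b ∩ Sᶜ ⊆ J) :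
    connectedComponentIn Sᶜ t = J := by
  refine Set.Subset.antisymm (fun x hx => hJ' ⟨⟨?_, ?_⟩, connectedComponentIn_subset _ _ hx⟩)
    (hJ.isPreconnected.subset_connectedComponentIn htJ hJS)
  all_goals
    have hC := (isPreconnected_connectedComponentIn (x := t) (F := Sᶜ)).ordConnected
    have ht := mem_connectedComponentIn (hJS htJ)
    by_contra! h
  · obtain ⟨s, ⟨hs, hst⟩, hxs, -⟩ := ha.exists_between h
    exact connectedComponentIn_subset _ _ (hC.out hx ht ⟨hxs.le, hst⟩) hs
  · obtain ⟨s, ⟨hs, hst⟩, -, hxs⟩ := hb.exists_between h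
    exact connectedComponentIn_subset _ _ (hC.out ht hx ⟨hst, hxs.le⟩) hs

/-- If at least one of the two endpoints of the gap of `S` around `t` belongs to `S`, the gap is
nondegenerate and the connected component of `t` in `Sᶜ` is an interval that is not closed. -/
theorem gap_component_of_endpoint_mem {S : Set ℝ} {t a b : ℝ} (ht : t ∉ S)
    (ha : IsLUB (S ∩ Set.Iic t) a) (hb : IsGLB (S ∩ Set.Ici t) b)
    (hat : a ≤ t) (htb : t ≤ b) (hab : a ∈ S ∨ b ∈ S) :
    a < b ∧ Set.Ioo a b ∩ S = ∅ ∧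
      (connectedComponentIn Sᶜ t = Set.Ioo a b ∨ connectedComponentIn Sᶜ t = Set.Ico a b ∨
        connectedComponentIn Sᶜ t = Set.Ioc a b) := by
  have hgap : ∀ x, a < x → x < b → x ∉ S := fun x hax hxb hx =>
    (le_total x t).elim (fun h => (ha.1 ⟨hx, h⟩).not_gt hax) (fun h => (hb.1 ⟨hx, h⟩).not_gt hxb)
  have hat' : a ∈ S → a < t := fun h => hat.lt_of_ne (by rintro rfl; exact ht h)
  have htb' : b ∈ S → t < b := fun h => htb.lt_of_ne (by rintro rfl; exact ht h)
  refine ⟨hab.elim (fun h => (hat' h).trans_le htb) (fun h => hat.trans_lt (htb' h)),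
    Set.eq_empty_of_forall_notMem fun x hx => hgap x hx.1.1 hx.1.2 hx.2, ?_⟩
  have hne : ∀ {x y}, x ∉ S → y ∈ S → x ≠ y := fun hx hy h => hx (h ▸ hy)
  by_cases haS : a ∈ S
  · by_cases hbS : b ∈ S
    · exact Or.inl <| connectedComponentIn_compl_eq ha hb Set.ordConnected_Ioo
        ⟨hat' haS, htb' hbS⟩ (fun x hx => hgap x hx.1 hx.2)
        fun x hx => ⟨hx.1.1.lt_of_ne (hne hx.2 haS).symm, hx.1.2.lt_of_ne (hne hx.2 hbS)⟩
    · exact Or.inr <| Or.inr <| connectedComponentIn_compl_eq ha hb Set.ordConnected_Ioc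
        ⟨hat' haS, htb⟩
        (fun x hx => hx.2.eq_or_lt.elim (fun h => h ▸ hbS) (hgap x hx.1))
        fun x hx => ⟨hx.1.1.lt_of_ne (hne hx.2 haS).symm, hx.1.2⟩
  · have hbS := hab.resolve_left haS
    exact Or.inr <| Or.inl <| connectedComponentIn_compl_eq ha hb Set.ordConnected_Ico
      ⟨hat, htb' hbS⟩
      (fun x hx => hx.1.eq_or_lt.elim (fun h => h ▸ haS) (fun h => hgap x h hx.2))
      fun x hx => ⟨hx.1.1, hx.1.2.lt_of_ne (hne hx.2 hbS)⟩

section OrderDivision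

variable {G : Type*} [Group G] [LinearOrder G] {e : Set G → ℝ} {X Y : Set G} {t : ℝ}

theorem IsOrderDivision.subset_total (hX : IsOrderDivision X) (hY : IsOrderDivision Y) :
    X ⊆ Y ∨ Y ⊆ X := by
  have lower {Z : Set G} (hZ : IsOrderDivision Z) : IsLowerSet Z := fun a b hba ha =>
    hba.eq_or_lt.elim (fun h => h ▸ ha) (hZ.2.2 a ha b)
  exact (lower hX).total (lower hY)

theorem IsEmbeddingMap.le_iff_subset (he : IsEmbeddingMap e) (hX : IsOrderDivision X)
    (hY : IsOrderDivision Y) : e X ≤ e Y ↔ X ⊆ Y := by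
  rw [← not_lt, he.2.1 Y hY X hX, ssubset_iff_subset_not_subset]
  have := hX.subset_total hY
  tauto

theorem IsEmbeddingMap.exists_gt (he : IsEmbeddingMap e) (t : ℝ) :
    ∃ C, IsOrderDivision C ∧ t < e C := by
  obtain ⟨C, hC, h⟩ := (he.2.2 (|t| + 1) (by positivity)).1
  exact ⟨C, hC, by linarith [le_abs_self t]⟩

theorem IsEmbeddingMap.exists_lt (he : IsEmbeddingMap e) (t : ℝ) :
    ∃ C, IsOrderDivision C ∧ e C < t := by
  obtain ⟨C, hC, h⟩ := (he.2.2 (|t| + 1) (by positivity)).2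
  exact ⟨C, hC, by linarith [neg_abs_le t]⟩

/-- The union `U` of all order divisions embedded at or below `t` is an order division: it contains
those embedded at or below `t` and is contained in those embedded at or above `t`. -/
theorem IsEmbeddingMap.exists_separating (he : IsEmbeddingMap e) (t : ℝ) :
    ∃ U, IsOrderDivision U ∧ (∀ C, IsOrderDivision C → e C ≤ t → e C ≤ e U) ∧
      ∀ C, IsOrderDivision C → t ≤ e C → e U ≤ e C := by
  let U : Set G := ⋃₀ {C | IsOrderDivision C ∧ e C ≤ t}
  have hUC {C : Set G} (hC : IsOrderDivision C) (h : t ≤ e C) : U ⊆ C :=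
    Set.sUnion_subset fun D hD => (he.le_iff_subset hD.1 hC).1 (hD.2.trans h)
  have hU : IsOrderDivision U := by
    obtain ⟨C, hC, hCt⟩ := he.exists_lt t
    obtain ⟨D, hD, htD⟩ := he.exists_gt t
    refine ⟨hC.1.mono (Set.subset_sUnion_of_mem ⟨hC, hCt.le⟩), fun h => ?_, ?_⟩
    · exact hD.2.1 (Set.univ_subset_iff.1 (h ▸ hUC hD htD.le))
    · rintro a ⟨B, hB, ha⟩ b hba
      exact ⟨B, hB, hB.1.2.2 a ha b hba⟩
  exact ⟨U, hU, fun C hC h => (he.le_iff_subset hC hU).2 (Set.subset_sUnion_of_mem ⟨hC, h⟩),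
    fun C hC h => (he.le_iff_subset hU hC).2 (hUC hC h)⟩

end OrderDivision

/-- Interval-type lemma (Subsection 4.2): for `t ∉ e(𝒞)`, with
`a = sup (e(𝒞) ∩ (-∞, t])` and `b = inf (e(𝒞) ∩ [t, +∞))`, one has `a < b`,
`(a, b)` is disjoint from `e(𝒞)`, at least one of `a, b` lies in `e(𝒞)`, and
the connected component of `ℝ − e(𝒞)` containing `t` is `(a,b)`, `[a,b)` or `(a,b]`. -/
theorem intervalType {G : Type*} [Group G] [LinearOrder G]
    [CovariantClass G G (· * ·) (· < ·)]
    (e : Set G → ℝ) (he : IsEmbeddingMap e) (t : ℝ)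
    (ht : t ∉ e '' {C : Set G | IsOrderDivision C}) :
    sSup (e '' {C : Set G | IsOrderDivision C} ∩ Set.Iic t) <
      sInf (e '' {C : Set G | IsOrderDivision C} ∩ Set.Ici t) ∧
    Set.Ioo (sSup (e '' {C : Set G | IsOrderDivision C} ∩ Set.Iic t))
        (sInf (e '' {C : Set G | IsOrderDivision C} ∩ Set.Ici t)) ∩
      e '' {C : Set G | IsOrderDivision C} = ∅ ∧
    (sSup (e '' {C : Set G | IsOrderDivision C} ∩ Set.Iic t) ∈
        e '' {C : Set G | IsOrderDivision C} ∨
      sInf (e '' {C : Set G | IsOrderDivision C} ∩ Set.Ici t) ∈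
        e '' {C : Set G | IsOrderDivision C}) ∧
    (connectedComponentIn (e '' {C : Set G | IsOrderDivision C})ᶜ t =
        Set.Ioo (sSup (e '' {C : Set G | IsOrderDivision C} ∩ Set.Iic t))
          (sInf (e '' {C : Set G | IsOrderDivision C} ∩ Set.Ici t)) ∨
      connectedComponentIn (e '' {C : Set G | IsOrderDivision C})ᶜ t =
        Set.Ico (sSup (e '' {C : Set G | IsOrderDivision C} ∩ Set.Iic t))
          (sInf (e '' {C : Set G | IsOrderDivision C} ∩ Set.Ici t)) ∨
      connectedComponentIn (e '' {C : Set G | IsOrderDivision C})ᶜ t =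
        Set.Ioc (sSup (e '' {C : Set G | IsOrderDivision C} ∩ Set.Iic t))
          (sInf (e '' {C : Set G | IsOrderDivision C} ∩ Set.Ici t))) := by
  obtain ⟨C, hC, hCt⟩ := he.exists_lt t
  obtain ⟨D, hD, htD⟩ := he.exists_gt t
  obtain ⟨U, hU, hUmax, hUmin⟩ := he.exists_separating t
  have hUS : e U ∈ e '' {C : Set G | IsOrderDivision C} := ⟨U, hU, rfl⟩
  have ha := isLUB_csSup (s := e '' {C : Set G | IsOrderDivision C} ∩ Set.Iic t)
    ⟨e C, ⟨C, hC, rfl⟩, hCt.le⟩ ⟨t, fun _ h => h.2⟩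
  have hb := isGLB_csInf (s := e '' {C : Set G | IsOrderDivision C} ∩ Set.Ici t)
    ⟨e D, ⟨D, hD, rfl⟩, htD.le⟩ ⟨t, fun _ h => h.2⟩
  have hmem : sSup (e '' {C : Set G | IsOrderDivision C} ∩ Set.Iic t) ∈
        e '' {C : Set G | IsOrderDivision C} ∨
      sInf (e '' {C : Set G | IsOrderDivision C} ∩ Set.Ici t) ∈
        e '' {C : Set G | IsOrderDivision C} := by
    rcases le_total (e U) t with h | h
    · left
      have hg : IsGreatest (e '' {C : Set G | IsOrderDivision C} ∩ Set.Iic t) (e U) :=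
        ⟨⟨hUS, h⟩, by rintro _ ⟨⟨X, hX, rfl⟩, hXt⟩; exact hUmax X hX hXt⟩
      rwa [hg.csSup_eq]
    · right
      have hl : IsLeast (e '' {C : Set G | IsOrderDivision C} ∩ Set.Ici t) (e U) :=
        ⟨⟨hUS, h⟩, by rintro _ ⟨⟨X, hX, rfl⟩, hXt⟩; exact hUmin X hX hXt⟩
      rwa [hl.csInf_eq]
  obtain ⟨hlt, hdisj, hcomp⟩ := gap_component_of_endpoint_mem ht ha hb
    (ha.2 fun _ h => h.2) (hb.2 fun _ h => h.2) hmem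
  exact ⟨hlt, hdisj, hmem, hcomp⟩
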